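/- Let p be an odd prime, F a field of characteristic not dividing 2p containing a primitive p-th root of unity θ, and let R = F[a, b, c_1, …, c_p] be a polynomial ring in p + 2 variables. Let I be the ideal of R generated by the p polynomials (c_i^p θ)^2 − (aθ^i + bθ^{-i})(c_i^p θ) + 1 for i = 1, …, p. Then I is a prime ideal of R. -/

import Mathlib

open MvPolynomial

theorem aux_linInd {M Ω : Type*} [Field M] [Field Ω] [Algebra M Ω] [IsGalois M Ω]
    {ι : Type*} (q : ℕ) (hq : 0 < q) (ζ : M) (hζ : IsPrimitiveRoot ζ q) (w : ι → Ω)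
    (h0 : ∀ i, w i ≠ 0) (hw : ∀ i, ∃ x : M, algebraMap M Ω x = w i ^ q)
    (hne : ∀ i j, i ≠ j → w i / w j ∉ Set.range (algebraMap M Ω)) :
    LinearIndependent M w := by
  have : NeZero q := ⟨hq.ne'⟩
  have key : ∀ i (σ : Ω ≃ₐ[M] Ω), ∃ z : M, σ (w i) = algebraMap M Ω z * w i := by
    intro i σ
    obtain ⟨x, hx⟩ := hw i
    have h1 : (σ (w i) / w i) ^ q = 1 := by
      rw [div_pow, ← map_pow, ← hx, AlgEquiv.commutes, div_self]
      rw [hx]; exact pow_ne_zero _ (h0 i)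
    obtain ⟨k, -, hk⟩ := (hζ.map_of_injective (algebraMap M Ω).injective).eq_pow_of_pow_eq_one h1
    refine ⟨ζ ^ k, ?_⟩
    rw [map_pow, hk, div_mul_cancel₀ _ (h0 i)]
  let χ : ι → ((Ω ≃ₐ[M] Ω) →* Ω) := fun i =>
    { toFun := fun σ => σ (w i) / w i
      map_one' := by simp [h0 i]
      map_mul' := by
        intro σ τ
        obtain ⟨z, hz⟩ := key i τ
        have := h0 i
        simp only [AlgEquiv.mul_apply, hz, map_mul, AlgEquiv.commutes]
        field_simp }
  have hχ : Function.Injective χ := by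
    intro i j hij
    by_contra hne'
    apply hne i j hne'
    rw [InfiniteGalois.mem_range_algebraMap_iff_fixed]
    intro σ
    have h1 : σ (w i) / w i = σ (w j) / w j := DFunLike.congr_fun hij σ
    have hi := h0 i
    have hj := h0 j
    have hj' : σ (w j) ≠ 0 := by simpa using hj
    rw [map_div₀]
    field_simp at h1 ⊢
    linear_combination h1
  have hli := (linearIndependent_monoidHom (Ω ≃ₐ[M] Ω) Ω).comp χ hχ
  rw [linearIndependent_iff'] at hli ⊢
  intro s g hg i hi
  have := hli s (fun i => algebraMap M Ω (g i) * w i) (by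
    ext σ
    have h2 := congrArg σ hg
    simp only [map_sum, Algebra.smul_def, map_mul, AlgEquiv.commutes, map_zero] at h2
    simp only [Finset.sum_apply, Pi.smul_apply, Function.comp, Pi.zero_apply, smul_eq_mul]
    rw [← h2]
    refine Finset.sum_congr rfl fun i _ => ?_
    change algebraMap M Ω (g i) * w i * (σ (w i) / w i) = _
    have := h0 i
    field_simp) i hi
  simpa [h0 i] using this

theorem aux_sign {K Ω : Type*} [Field K] [Field Ω] [Algebra K Ω] {s : Ω} 
    (hs : ∃ x : K, algebraMap K Ω x = s ^ 2) (σ : Ω ≃ₐ[K] Ω) : σ s = s ∨ σ s = - s := by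
  obtain ⟨x, hx⟩ := hs
  rw [← sq_eq_sq_iff_eq_or_eq_neg, ← map_pow, ← hx, AlgEquiv.commutes]

theorem aux_sigma {K Ω : Type*} [Field K] [Field Ω] [Algebra K Ω] [IsGalois K Ω]
    {ι : Type*} [DecidableEq ι] (s : ι → Ω) (hs : ∀ i, ∃ x : K, algebraMap K Ω x = s i ^ 2)
    (hD : ∀ D : Finset ι, D.Nonempty → ∏ i ∈ D, s i ∉ Set.range (algebraMap K Ω))
    (T : Finset ι) : ∀ D : Finset ι, D.Nonempty → Disjoint D T →
      ∃ σ : Ω ≃ₐ[K] Ω, (∀ i ∈ T, σ (s i) = s i) ∧ σ (∏ i ∈ D, s i) = - ∏ i ∈ D, s i := by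
  have hs' : ∀ D : Finset ι, ∃ x : K, algebraMap K Ω x = (∏ i ∈ D, s i) ^ 2 := by
    choose x hx using hs
    intro D
    exact ⟨∏ i ∈ D, x i, by rw [map_prod, ← Finset.prod_pow]; simp [hx]⟩
  induction T using Finset.induction_on with
  | empty =>
    intro D hDn _
    have := hD D hDn
    rw [InfiniteGalois.mem_range_algebraMap_iff_fixed] at this
    push Not at this
    obtain ⟨σ, hσ⟩ := this
    exact ⟨σ, by simp, (aux_sign (hs' D) σ).resolve_left hσ⟩
  | insert k T hk ih =>
    intro D hDn hdisj
    rw [Finset.disjoint_insert_right] at hdisj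
    obtain ⟨σ, h1, h2⟩ := ih D hDn hdisj.2
    rcases aux_sign (hs k) σ with h3 | h3
    · exact ⟨σ, by simpa [h3] using h1, h2⟩
    obtain ⟨τ, h4, h5⟩ := ih (insert k D) (by simp) (by simp [hk, hdisj.2])
    rw [Finset.prod_insert hdisj.1, map_mul] at h5
    have hk0 : s k ≠ 0 := by
      intro h
      exact hD {k} (by simp) ⟨0, by simp [h]⟩
    rcases aux_sign (hs k) τ with h6 | h6
    · refine ⟨τ, by simpa [h6] using h4, ?_⟩
      rw [h6] at h5
      exact mul_left_cancel₀ hk0 (by linear_combination h5)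
    · refine ⟨σ * τ, ?_, ?_⟩
      · intro i hi
        rcases Finset.mem_insert.1 hi with rfl | hi
        · simp [h6, h3]
        · simp [h4 i hi, h1 i hi]
      · rw [h6] at h5
        have : τ (∏ i ∈ D, s i) = ∏ i ∈ D, s i :=
          mul_left_cancel₀ hk0 (by linear_combination -h5)
        rw [AlgEquiv.mul_apply, this, h2]

theorem aux_core {K Ω : Type*} [Field K] [Field Ω] [Algebra K Ω] [IsGalois K Ω]
    {ι : Type*} [DecidableEq ι] [Fintype ι] (p : ℕ) (hp : p.Prime) (hodd : Odd p)
    (h2 : (2 : K) ≠ 0) (θ : K) (hθ : IsPrimitiveRoot θ p)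
    (L : ι → K) (s : ι → Ω) (hs : ∀ i, s i ^ 2 = algebraMap K Ω (L i ^ 2 - 4))
    (hD : ∀ D : Finset ι, D.Nonempty → ∏ i ∈ D, s i ∉ Set.range (algebraMap K Ω))
    (hdick : ∀ j t, (Polynomial.dickson 1 (1 : K) p).eval t ≠ L j)
    (u : ι → Ω) (hu : ∀ i, 2 * u i = algebraMap K Ω (L i) + s i)
    (d : ι → ℤ) (j : ι) (hj : ¬ (p : ℤ) ∣ d j) (c : K) (hc : c ≠ 0) (w : Ω)
    (hwK : w ∈ IntermediateField.adjoin K (Set.range s))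
    (hw : w ^ p = algebraMap K Ω c * ∏ i, u i ^ d i) : False := by
  have h2' : (2 : Ω) ≠ 0 := by
    have := (map_ne_zero (algebraMap K Ω)).2 h2
    rwa [map_ofNat] at this
  have hs' : ∀ i, ∃ x : K, algebraMap K Ω x = s i ^ 2 := fun i => ⟨_, (hs i).symm⟩
  have hub : ∀ i, u i * ((algebraMap K Ω (L i) - s i) / 2) = 1 := by
    intro i
    have h1 := hu i
    have h3 := hs i
    simp only [map_sub, map_pow, map_ofNat] at h3
    have : u i = (algebraMap K Ω (L i) + s i) / 2 := by
      field_simp; linear_combination h1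
    rw [this]
    field_simp
    linear_combination -h3
  have hu0 : ∀ i, u i ≠ 0 := fun i => left_ne_zero_of_mul_eq_one (hub i)
  have huinv : ∀ i, 2 * (u i)⁻¹ = algebraMap K Ω (L i) - s i := by
    intro i
    rw [inv_eq_of_mul_eq_one_right (hub i)]
    field_simp
  have fixu : ∀ (τ : Ω ≃ₐ[K] Ω) i, τ (s i) = s i → τ (u i) = u i := by
    intro τ i h
    apply mul_left_cancel₀ h2'
    have := congrArg τ (hu i)
    rw [map_mul, map_add, AlgEquiv.commutes, h, map_ofNat] at this
    rw [this, hu]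
  have negu : ∀ (τ : Ω ≃ₐ[K] Ω) i, τ (s i) = - s i → τ (u i) = (u i)⁻¹ := by
    intro τ i h
    apply mul_left_cancel₀ h2'
    have := congrArg τ (hu i)
    rw [map_mul, map_add, AlgEquiv.commutes, h, map_ofNat] at this
    rw [this, huinv]; ring
  have hsq : ∀ (τ : Ω ≃ₐ[K] Ω) v, v ∈ IntermediateField.adjoin K (Set.range s) → τ (τ v) = v := by
    intro τ v hv
    induction hv using IntermediateField.adjoin_induction with
    | mem x hx =>
      obtain ⟨i, rfl⟩ := hx
      rcases aux_sign (hs' i) τ with h | h <;> simp [h]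
    | algebraMap x => simp
    | add x y _ _ hx hy => simp [hx, hy]
    | inv x _ hx => simp [hx]
    | mul x y _ _ hx hy => simp [hx, hy]
  have hcl : ∀ (τ : Ω ≃ₐ[K] Ω) v, v ∈ IntermediateField.adjoin K (Set.range s) →
      τ v ∈ IntermediateField.adjoin K (Set.range s) := by
    intro τ v hv
    induction hv using IntermediateField.adjoin_induction with
    | mem x hx =>
      have := IntermediateField.subset_adjoin K _ hx
      obtain ⟨i, rfl⟩ := hx
      rcases aux_sign (hs' i) τ with h | h <;> simp [h] <;> exact this
    | algebraMap x => simp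
    | add x y _ _ hx hy => rw [map_add]; exact add_mem hx hy
    | inv x _ hx => rw [map_inv₀]; exact inv_mem hx
    | mul x y _ _ hx hy => rw [map_mul]; exact mul_mem hx hy
  have husub : ∀ i, u i ∈ IntermediateField.adjoin K (Set.range s) := by
    intro i
    have : u i = (algebraMap K Ω (L i) + s i) / algebraMap K Ω 2 := by
      rw [← hu i, map_ofNat]; field_simp
    rw [this]
    exact div_mem (add_mem (IntermediateField.algebraMap_mem _ _)
      (IntermediateField.subset_adjoin K _ ⟨i, rfl⟩)) (IntermediateField.algebraMap_mem _ _)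
  obtain ⟨σ, hσ1, hσ2⟩ := aux_sigma s hs' hD (Finset.univ.erase j) {j} (by simp) (by simp)
  rw [Finset.prod_singleton] at hσ2
  have hσj := negu σ j hσ2
  have hσi : ∀ i, i ≠ j → σ (u i) = u i := fun i hi => fixu σ i (hσ1 i (by simp [hi]))
  have hc' : algebraMap K Ω c ≠ 0 := (map_ne_zero _).2 hc
  have hP0 : ∏ i ∈ Finset.univ.erase j, u i ^ d i ≠ 0 :=
    Finset.prod_ne_zero_iff.2 fun i _ => zpow_ne_zero _ (hu0 i)
  have hw0 : w ≠ 0 := by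
    rintro rfl
    rw [zero_pow hp.ne_zero] at hw
    exact mul_ne_zero hc' (Finset.prod_ne_zero_iff.2 fun i _ => zpow_ne_zero _ (hu0 i)) hw.symm
  have hσw0 : σ w ≠ 0 := by simpa using hw0
  rw [← Finset.mul_prod_erase Finset.univ _ (Finset.mem_univ j)] at hw
  have hσw : (σ w) ^ p = algebraMap K Ω c * ((u j ^ d j)⁻¹ *
      ∏ i ∈ Finset.univ.erase j, u i ^ d i) := by
    rw [← map_pow, hw, map_mul, map_mul, AlgEquiv.commutes, map_prod, map_zpow₀, hσj, inv_zpow]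
    congr 2
    refine Finset.prod_congr rfl fun i hi => ?_
    rw [map_zpow₀, hσi i (Finset.ne_of_mem_erase hi)]
  have hy : (w / σ w) ^ p = u j ^ (2 * d j) := by
    rw [div_pow, hw, hσw, two_mul, zpow_add₀ (hu0 j)]
    have := zpow_ne_zero (d j) (hu0 j)
    field_simp
  have hσy : σ (w / σ w) = (w / σ w)⁻¹ := by
    rw [map_div₀, hsq σ w hwK, inv_div]
  have hcop : IsCoprime (2 * d j) (p : ℤ) := by
    have hpp := Nat.prime_iff_prime_int.1 hp
    rw [isCoprime_comm, (Prime.irreducible hpp).coprime_iff_not_dvd]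
    intro h
    rcases hpp.dvd_or_dvd h with h | h
    · have h' : p ∣ 2 := by exact_mod_cast h
      have := (Nat.prime_dvd_prime_iff_eq hp Nat.prime_two).1 h'
      subst this
      exact absurd hodd (by decide)
    · exact hj h
  obtain ⟨a, b, hab⟩ := hcop
  have hy0 : w / σ w ≠ 0 := div_ne_zero hw0 hσw0
  obtain ⟨v, hv⟩ : ∃ v, v = (w / σ w) ^ a * u j ^ b := ⟨_, rfl⟩
  have hvp : v ^ p = u j := by
    rw [hv, mul_pow, ← zpow_natCast, ← zpow_natCast, ← zpow_mul, ← zpow_mul, mul_comm a,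
      zpow_mul, zpow_natCast, hy, ← zpow_mul, ← zpow_add₀ (hu0 j),
      show 2 * d j * a + b * p = 1 by linarith, zpow_one]
  have hσv : σ v = v⁻¹ := by
    rw [hv, map_mul, map_zpow₀, map_zpow₀, hσy, hσj, inv_zpow, inv_zpow, mul_inv]
  have hvK : v ∈ IntermediateField.adjoin K (Set.range s) := by
    rw [hv]
    exact mul_mem (zpow_mem (div_mem hwK (hcl σ w hwK)) _) (zpow_mem (husub j) _)
  have hv0 : v ≠ 0 := by
    rintro rfl
    rw [zero_pow hp.ne_zero] at hvp
    exact hu0 j hvp.symm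
  have fixv : ∀ τ : Ω ≃ₐ[K] Ω, τ (s j) = s j → τ v = v := by
    intro τ hτ
    have h1 : (τ v / v) ^ p = 1 := by
      rw [div_pow, ← map_pow, hvp, fixu τ j hτ, div_self (hu0 j)]
    have : NeZero p := ⟨hp.ne_zero⟩
    obtain ⟨k, -, hk⟩ := (hθ.map_of_injective (algebraMap K Ω).injective).eq_pow_of_pow_eq_one h1
    rw [← map_pow, eq_div_iff hv0] at hk
    have h3 := hsq τ v hvK
    have hk1 : (algebraMap K Ω (θ ^ k)) ^ 2 = 1 := by
      rw [← hk, map_mul, AlgEquiv.commutes, ← hk] at h3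
      apply mul_right_cancel₀ hv0
      linear_combination h3
    have hk2 : (algebraMap K Ω (θ ^ k)) ^ p = 1 := by
      rw [← map_pow, ← pow_mul, mul_comm, pow_mul, hθ.pow_eq_one]; simp
    obtain ⟨m, hm⟩ := hodd
    rw [hm, pow_add, pow_mul, hk1, one_pow, one_mul, pow_one] at hk2
    rw [← hk, hk2, one_mul]
  have hfix : v + v⁻¹ ∈ Set.range (algebraMap K Ω) := by
    rw [InfiniteGalois.mem_range_algebraMap_iff_fixed]
    intro τ
    rcases aux_sign (hs' j) τ with h | h
    · rw [map_add, map_inv₀, fixv τ h]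
    · have h1 := fixv (σ * τ) (by simp [h, hσ2])
      have h3 : τ v = v⁻¹ := by
        apply σ.injective
        rw [map_inv₀, hσv, inv_inv]; exact h1
      rw [map_add, map_inv₀, h3, inv_inv, add_comm]
  obtain ⟨t, ht⟩ := hfix
  apply hdick j t
  apply (algebraMap K Ω).injective
  have h5 := Polynomial.dickson_one_one_eval_add_inv v v⁻¹ (mul_inv_cancel₀ hv0) p
  rw [← ht, inv_pow, hvp] at h5
  have h6 : Polynomial.dickson 1 (1 : Ω) p = (Polynomial.dickson 1 (1 : K) p).map (algebraMap K Ω) := by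
    rw [Polynomial.map_dickson, map_one]
  rw [h6, Polynomial.eval_map_algebraMap, Polynomial.aeval_algebraMap_apply] at h5
  rw [← Polynomial.coe_aeval_eq_eval, h5]
  apply mul_left_cancel₀ h2'
  linear_combination hu j + huinv j

theorem aux_dick_deg (F : Type*) [Field F] (n : ℕ) :
    (Polynomial.dickson 1 (1 : F) (n + 1)).Monic ∧
      (Polynomial.dickson 1 (1 : F) (n + 1)).natDegree = n + 1 := by
  have key : ∀ n, (Polynomial.dickson 1 (1 : F) (n + 1)).degree = (n + 1 : ℕ) ∧
      (Polynomial.dickson 1 (1 : F) (n + 1)).leadingCoeff = 1 ∧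
      (Polynomial.dickson 1 (1 : F) n).degree ≤ n := by
    intro n
    induction n with
    | zero =>
      simp only [Polynomial.dickson_zero, zero_add, Polynomial.dickson_one]
      refine ⟨by simp, by simp, ?_⟩
      have : (3 - ((1 : ℕ) : Polynomial F)) = Polynomial.C 2 := by
        push_cast; rw [map_ofNat]; norm_num
      rw [this]
      exact Polynomial.degree_C_le
    | succ n ih =>
      obtain ⟨h1, h2, h3⟩ := ih
      have hlt : (Polynomial.C (1 : F) * Polynomial.dickson 1 (1 : F) n).degree <
          (Polynomial.X * Polynomial.dickson 1 (1 : F) (n + 1)).degree := by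
        rw [map_one, one_mul, Polynomial.degree_mul, h1, Polynomial.degree_X]
        refine lt_of_le_of_lt h3 ?_
        norm_cast
        omega
      rw [Polynomial.dickson_add_two]
      refine ⟨?_, ?_, h1.le⟩
      · rw [Polynomial.degree_sub_eq_left_of_degree_lt hlt, Polynomial.degree_mul, h1,
          Polynomial.degree_X]
        norm_cast
        omega
      · rw [Polynomial.leadingCoeff_sub_of_degree_lt hlt, Polynomial.leadingCoeff_mul, h2]
        simp
  obtain ⟨h1, h2, -⟩ := key n
  exact ⟨h2, Polynomial.natDegree_eq_of_degree_eq_some h1⟩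

/-- the linear form -/
noncomputable def auxL {F : Type*} [Field F] (α β : F) : MvPolynomial (Fin 2) F :=
  C α * X 0 + C β * X 1

theorem auxL_map {F : Type*} [Field F] (α β : F) (hα : α ≠ 0) :
    aeval (R := F) ![Polynomial.C α⁻¹ * Polynomial.X, 0] (auxL α β) = Polynomial.X := by
  simp only [auxL, map_add, map_mul, aeval_X, algHom_C, Matrix.cons_val_zero,
    Matrix.cons_val_one, mul_zero, add_zero, Polynomial.algebraMap_eq, ← mul_assoc]
  rw [← map_mul, mul_inv_cancel₀ hα, map_one, one_mul]

theorem aux_dick_ne {F : Type*} [Field F] (α β : F) (hα : α ≠ 0) (p : ℕ) (hp : 2 ≤ p)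
    (t : FractionRing (MvPolynomial (Fin 2) F)) :
    (Polynomial.dickson 1 (1 : FractionRing (MvPolynomial (Fin 2) F)) p).eval t ≠
      algebraMap (MvPolynomial (Fin 2) F) _ (auxL α β) := by
  intro h
  obtain ⟨n, rfl⟩ : ∃ n, p = n + 1 := ⟨p - 1, by omega⟩
  obtain ⟨hm, hdeg⟩ := aux_dick_deg F n
  set A := MvPolynomial (Fin 2) F
  have hA : Polynomial.dickson 1 (1 : A) (n + 1) =
      (Polynomial.dickson 1 (1 : F) (n + 1)).map (algebraMap F A) := by
    rw [Polynomial.map_dickson, map_one]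
  have hK : Polynomial.dickson 1 (1 : FractionRing A) (n + 1) =
      (Polynomial.dickson 1 (1 : A) (n + 1)).map (algebraMap A (FractionRing A)) := by
    rw [Polynomial.map_dickson, map_one]
  have hmA : (Polynomial.dickson 1 (1 : A) (n + 1)).Monic := by
    rw [hA]; exact hm.map _
  have hInteg : IsIntegral A t := by
    refine ⟨Polynomial.dickson 1 (1 : A) (n + 1) - Polynomial.C (auxL α β), ?_, ?_⟩
    · apply hmA.sub_of_left
      refine lt_of_le_of_lt Polynomial.degree_C_le ?_
      rw [Polynomial.degree_eq_natDegree hmA.ne_zero, hA, hm.natDegree_map, hdeg]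
      norm_cast
      omega
    · rw [Polynomial.eval₂_sub, Polynomial.eval₂_C, ← Polynomial.eval_map, ← hK, h, sub_self]
  obtain ⟨y, rfl⟩ := IsIntegrallyClosed.isIntegral_iff.1 hInteg
  rw [hK, Polynomial.eval_map_algebraMap, Polynomial.aeval_algebraMap_apply] at h
  have h' := IsFractionRing.injective A (FractionRing A) h
  let f : A →ₐ[F] Polynomial F := aeval ![Polynomial.C α⁻¹ * Polynomial.X, 0]
  have h3 := congrArg f h'
  have h4 : f (auxL α β) = Polynomial.X := by
    exact auxL_map α β hα
  rw [h4, hA, Polynomial.aeval_map_algebraMap, ← Polynomial.aeval_algHom_apply] at h3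
  have h5 := congrArg Polynomial.natDegree h3
  rw [← Polynomial.comp_eq_aeval, Polynomial.natDegree_comp, hdeg, Polynomial.natDegree_X] at h5
  have := Nat.eq_one_of_mul_eq_one_right h5
  omega

theorem aux_prime {F : Type*} [Field F] (α β γ : F) (hα : α ≠ 0) :
    Prime (auxL α β - C γ) := by
  rw [← irreducible_iff_prime]
  have : auxL α β - C γ = C α * X 0 + (C β * X 1 - C γ) := by rw [auxL]; ring
  rw [this]
  apply irreducible_mul_X_add
  · simpa using hα
  · simp
  · intro h
    have h1 := vars_sub_subset _ h
    simp only [vars_C, Finset.union_empty] at h1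
    have h2 := vars_mul _ _ h1
    simp at h2
  · apply IsUnit.isRelPrime_left
    simpa using hα

theorem aux_nsq {F : Type*} [Field F] (h2 : (2 : F) ≠ 0) {ι : Type*} [DecidableEq ι]
    (α β : ι → F) (hα : ∀ i, α i ≠ 0)
    (hne : ∀ i j, i ≠ j → α i * β j - α j * β i ≠ 0) (D : Finset ι) (hD : D.Nonempty)
    (k : FractionRing (MvPolynomial (Fin 2) F)) :
    k ^ 2 ≠ algebraMap (MvPolynomial (Fin 2) F) _ (∏ i ∈ D, (auxL (α i) (β i) ^ 2 - 4)) := by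
  intro hk
  have hInteg : IsIntegral (MvPolynomial (Fin 2) F) k := by
    apply IsIntegral.of_pow (n := 2) (by norm_num)
    rw [hk]; exact isIntegral_algebraMap
  obtain ⟨y, rfl⟩ := IsIntegrallyClosed.isIntegral_iff.1 hInteg
  rw [← map_pow] at hk
  have h := IsFractionRing.injective _ (FractionRing (MvPolynomial (Fin 2) F)) hk
  obtain ⟨i, hi⟩ := hD
  have hp := aux_prime (α i) (β i) 2 (hα i)
  set P := auxL (α i) (β i) - C 2 with hP
  have hfac : auxL (α i) (β i) ^ 2 - 4 = P * (auxL (α i) (β i) + 2) := by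
    rw [hP, map_ofNat]; ring
  rw [← Finset.mul_prod_erase D _ hi, hfac, mul_assoc] at h
  have hdy : P ∣ y := hp.dvd_of_dvd_pow (n := 2) ⟨_, h⟩
  obtain ⟨z, rfl⟩ := hdy
  have h' : P * z ^ 2 = (auxL (α i) (β i) + 2) *
      ∏ x ∈ D.erase i, (auxL (α x) (β x) ^ 2 - 4) :=
    mul_left_cancel₀ hp.ne_zero (by linear_combination h)
  have hdv : P ∣ (auxL (α i) (β i) + 2) * ∏ x ∈ D.erase i, (auxL (α x) (β x) ^ 2 - 4) :=
    ⟨_, h'.symm⟩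
  have h4 : (4 : F) ≠ 0 := by
    have : (4 : F) = 2 * 2 := by norm_num
    rw [this]; exact mul_ne_zero h2 h2
  rcases hp.dvd_or_dvd hdv with ⟨g, hg⟩ | hdv
  · have := congrArg (aeval (R := F) ![2 * (α i)⁻¹, 0]) hg
    simp only [hP, auxL, map_add, map_mul, map_sub, aeval_X, algHom_C, map_ofNat] at this
    have hi := hα i
    simp at this
    field_simp at this
    apply h2
    linear_combination this
  · rw [hp.dvd_finsetProd_iff] at hdv
    obtain ⟨j, hj, g, hg⟩ := hdv
    have hij := hne i j (Finset.ne_of_mem_erase hj).symm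
    have := congrArg (aeval (R := F) ![2 * β j / (α i * β j - α j * β i),
      - 2 * α j / (α i * β j - α j * β i)]) hg
    simp only [hP, auxL, map_add, map_mul, map_sub, map_pow, aeval_X, algHom_C, map_ofNat] at this
    have e1 : α i * (2 * β j / (α i * β j - α j * β i)) +
      β i * (- 2 * α j / (α i * β j - α j * β i)) = 2 := by
      field_simp; ring
    have e2 : α j * (2 * β j / (α i * β j - α j * β i)) +
      β j * (- 2 * α j / (α i * β j - α j * β i)) = 0 := by
      field_simp; ring
    simp only [Algebra.algebraMap_self, RingHom.id_apply, Matrix.cons_val_zero,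
      Matrix.cons_val_one] at this
    rw [e1, e2] at this
    apply h4
    linear_combination -this

theorem aux_span {A Q : Type*} [CommRing A] [CommRing Q] [Algebra A Q] {ι : Type*} [Fintype ι]
    [DecidableEq ι] (p : ℕ) (hp : 0 < p) (s c : ι → Q) (d α β : ι → A)
    (hs : ∀ i, s i ^ 2 = algebraMap A Q (d i))
    (hc : ∀ i, c i ^ p = algebraMap A Q (α i) + algebraMap A Q (β i) * s i)
    (hgen : Algebra.adjoin A (Set.range c) = ⊤) :
    Submodule.span A (Set.range (fun x : (ι → Fin 2) × (ι → Fin p) =>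
      (∏ i, s i ^ (x.1 i : ℕ)) * ∏ i, c i ^ (x.2 i : ℕ))) = ⊤ := by
  set N := Submodule.span A (Set.range (fun x : (ι → Fin 2) × (ι → Fin p) =>
      (∏ i, s i ^ (x.1 i : ℕ)) * ∏ i, c i ^ (x.2 i : ℕ))) with hN
  have upd : ∀ (f : ι → Q) {k : ℕ} (m : ι → Fin k) (j : ι) (a : Fin k),
      ∏ i, f i ^ (Function.update m j a i : ℕ) =
        f j ^ (a : ℕ) * ∏ i ∈ Finset.univ.erase j, f i ^ (m i : ℕ) := by
    intro f k m j a
    rw [← Finset.mul_prod_erase Finset.univ _ (Finset.mem_univ j), Function.update_self]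
    congr 1
    refine Finset.prod_congr rfl fun i hi => ?_
    rw [Function.update_of_ne (Finset.ne_of_mem_erase hi)]
  have hmemN : ∀ (m : ι → Fin 2) (n : ι → Fin p),
      (∏ i, s i ^ (m i : ℕ)) * ∏ i, c i ^ (n i : ℕ) ∈ N :=
    fun m n => Submodule.subset_span ⟨(m, n), rfl⟩
  have hsN : ∀ j x, x ∈ N → s j * x ∈ N := by
    intro j x hx
    induction hx using Submodule.span_induction with
    | mem x hx =>
      obtain ⟨⟨m, n⟩, rfl⟩ := hx
      dsimp only
      rw [← Finset.mul_prod_erase Finset.univ (fun i => s i ^ (m i : ℕ)) (Finset.mem_univ j)]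
      by_cases h : m j = 0
      · have := hmemN (Function.update m j 1) n
        rw [upd] at this
        rw [h]
        convert this using 1
        simp
        ring
      · have h1 : m j = 1 := by omega
        have := N.smul_mem (d j) (hmemN (Function.update m j 0) n)
        rw [upd, Algebra.smul_def, ← hs] at this
        rw [h1]
        convert this using 1
        simp
        ring
    | zero => simp
    | add x y _ _ hx hy => rw [mul_add]; exact add_mem hx hy
    | smul a x _ hx => rw [mul_smul_comm]; exact N.smul_mem _ hx
  have hcN : ∀ j x, x ∈ N → c j * x ∈ N := by
    intro j x hx
    induction hx using Submodule.span_induction with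
    | mem x hx =>
      obtain ⟨⟨m, n⟩, rfl⟩ := hx
      dsimp only
      by_cases h : (n j : ℕ) + 1 < p
      · have := hmemN m (Function.update n j ⟨n j + 1, h⟩)
        rw [upd] at this
        convert this using 1
        rw [← Finset.mul_prod_erase Finset.univ (fun i => c i ^ (n i : ℕ)) (Finset.mem_univ j)]
        simp only [pow_succ]
        ring
      · have h1 : (n j : ℕ) + 1 = p := by omega
        have h0 := hmemN m (Function.update n j ⟨0, hp⟩)
        have := add_mem (N.smul_mem (α j) h0) (N.smul_mem (β j) (hsN j _ h0))
        rw [upd, Algebra.smul_def, Algebra.smul_def, ← mul_assoc (algebraMap A Q (β j)),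
          ← add_mul, ← hc] at this
        convert this using 1
        rw [← Finset.mul_prod_erase Finset.univ (fun i => c i ^ (n i : ℕ)) (Finset.mem_univ j)]
        have h3 : c j ^ p = c j ^ (n j : ℕ) * c j := by rw [← pow_succ, h1]
        rw [h3]
        simp only [pow_zero]
        ring
    | zero => simp
    | add x y _ _ hx hy => rw [mul_add]; exact add_mem hx hy
    | smul a x _ hx => rw [mul_smul_comm]; exact N.smul_mem _ hx
  have hone : (1 : Q) ∈ N := by
    have := hmemN (fun _ => 0) (fun _ => ⟨0, hp⟩)
    simpa using this
  have hall : ∀ q x : Q, x ∈ N → q * x ∈ N := by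
    intro q
    have hq : q ∈ Algebra.adjoin A (Set.range c) := hgen ▸ Algebra.mem_top
    induction hq using Algebra.adjoin_induction with
    | mem q hq => obtain ⟨j, rfl⟩ := hq; exact hcN j
    | algebraMap a => intro x hx; rw [← Algebra.smul_def]; exact N.smul_mem _ hx
    | add a b _ _ ha hb => intro x hx; rw [add_mul]; exact add_mem (ha x hx) (hb x hx)
    | mul a b _ _ ha hb => intro x hx; rw [mul_assoc]; exact ha _ (hb x hx)
  rw [eq_top_iff]
  intro q _
  simpa using hall q 1 hone

theorem aux_linInd_main {K Ω : Type*} [Field K] [Field Ω] [Algebra K Ω] [IsGalois K Ω]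
    {ι : Type*} [DecidableEq ι] [Fintype ι] (p : ℕ) (hp : p.Prime) (hodd : Odd p)
    (h2 : (2 : K) ≠ 0) (θ : K) (hθ : IsPrimitiveRoot θ p)
    (L : ι → K) (s : ι → Ω) (hs : ∀ i, s i ^ 2 = algebraMap K Ω (L i ^ 2 - 4))
    (hD : ∀ D : Finset ι, D.Nonempty → ∏ i ∈ D, s i ∉ Set.range (algebraMap K Ω))
    (hdick : ∀ j t, (Polynomial.dickson 1 (1 : K) p).eval t ≠ L j)
    (c : ι → Ω) (hc : ∀ i, 2 * (c i ^ p * algebraMap K Ω θ) = algebraMap K Ω (L i) + s i)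
    (hc0 : ∀ i, c i ≠ 0) :
    LinearIndependent K (fun x : (ι → Fin 2) × (ι → Fin p) =>
      (∏ i, s i ^ (x.1 i : ℕ)) * ∏ i, c i ^ (x.2 i : ℕ)) := by
  have h2' : (2 : Ω) ≠ 0 := by
    have := (map_ne_zero (algebraMap K Ω)).2 h2
    rwa [map_ofNat] at this
  have hs' : ∀ i, ∃ x : K, algebraMap K Ω x = s i ^ 2 := fun i => ⟨_, (hs i).symm⟩
  have hs0 : ∀ i, s i ≠ 0 := fun i h => hD {i} (by simp) ⟨0, by simp [h]⟩
  have hsm : ∀ i, s i ∈ IntermediateField.adjoin K (Set.range s) :=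
    fun i => IntermediateField.subset_adjoin K _ ⟨i, rfl⟩
  have hθ0 : θ ≠ 0 := hθ.ne_zero hp.ne_zero
  let b : (ι → Fin 2) → IntermediateField.adjoin K (Set.range s) := fun m =>
    ∏ i, (⟨s i, hsm i⟩ : IntermediateField.adjoin K (Set.range s)) ^ (m i : ℕ)
  have hb' : ∀ m, ((b m : IntermediateField.adjoin K (Set.range s)) : Ω) =
      ∏ i, s i ^ (m i : ℕ) := by
    intro m
    have := map_prod (IntermediateField.adjoin K (Set.range s)).val
      (fun i => (⟨s i, hsm i⟩ : IntermediateField.adjoin K (Set.range s)) ^ (m i : ℕ)) Finset.univ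
    simp only [map_pow] at this
    exact this
  have hbΩ : LinearIndependent K (fun m : ι → Fin 2 => ∏ i, s i ^ (m i : ℕ)) := by
    have hneg : (-1 : K) ≠ 1 := by
      intro h; apply h2; linear_combination -h
    apply aux_linInd 2 (by norm_num) (-1 : K)
    · refine IsPrimitiveRoot.mk_of_lt _ (by norm_num) (by norm_num) ?_
      intro l h0 hl
      have : l = 1 := by omega
      subst this
      simpa using hneg
    · intro m
      exact Finset.prod_ne_zero_iff.2 fun i _ => pow_ne_zero _ (hs0 i)
    · intro m
      choose x hx using hs'
      refine ⟨∏ i, x i ^ (m i : ℕ), ?_⟩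
      rw [map_prod, ← Finset.prod_pow]
      refine Finset.prod_congr rfl fun i _ => ?_
      rw [map_pow, hx]; ring
    · rintro m n hmn ⟨x, hx⟩
      obtain ⟨j, hj⟩ := Function.ne_iff.1 hmn
      obtain ⟨σ, hσ1, hσ2⟩ := aux_sigma s hs' hD (Finset.univ.erase j) {j} (by simp) (by simp)
      rw [Finset.prod_singleton] at hσ2
      have hσ : ∀ m : ι → Fin 2, σ (∏ i, s i ^ (m i : ℕ)) =
          (-1) ^ (m j : ℕ) * ∏ i, s i ^ (m i : ℕ) := by
        intro m
        rw [← Finset.mul_prod_erase Finset.univ _ (Finset.mem_univ j), map_mul, map_pow, hσ2,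
          neg_pow, map_prod, mul_assoc]
        congr 2
        refine Finset.prod_congr rfl fun i hi => ?_
        rw [map_pow, hσ1 i hi]
      have hm0 : ∏ i, s i ^ (m i : ℕ) ≠ 0 :=
        Finset.prod_ne_zero_iff.2 fun i _ => pow_ne_zero _ (hs0 i)
      have hn0 : ∏ i, s i ^ (n i : ℕ) ≠ 0 :=
        Finset.prod_ne_zero_iff.2 fun i _ => pow_ne_zero _ (hs0 i)
      rw [eq_div_iff hn0] at hx
      have h3 := congrArg σ hx
      rw [map_mul, AlgEquiv.commutes, hσ, hσ, ← hx] at h3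
      have hx0 : algebraMap K Ω x * ∏ i, s i ^ (n i : ℕ) ≠ 0 := by rw [hx]; exact hm0
      have h4 : (-1 : Ω) ^ (n j : ℕ) = (-1) ^ (m j : ℕ) :=
        mul_right_cancel₀ hx0 (by linear_combination h3)
      have hnegΩ : (-1 : Ω) ≠ 1 := by
        intro h; apply h2'; linear_combination -h
      have cases2 : ∀ a : Fin 2, a = 0 ∨ a = 1 := by decide
      rcases cases2 (m j) with e | e <;> rcases cases2 (n j) with e' | e' <;>
        rw [e, e'] at h4 hj
      · exact hj rfl
      · exact hnegΩ (by simpa using h4)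
      · exact hnegΩ (by simpa using h4.symm)
      · exact hj rfl
  have hb : LinearIndependent K b := by
    apply LinearIndependent.of_comp (IntermediateField.adjoin K (Set.range s)).val.toLinearMap
    have e : (⇑(IntermediateField.adjoin K (Set.range s)).val.toLinearMap ∘ b) =
        fun m : ι → Fin 2 => ∏ i, s i ^ (m i : ℕ) := funext hb'
    rw [e]
    exact hbΩ
  have hu0 : ∀ i, c i ^ p * algebraMap K Ω θ ≠ 0 :=
    fun i => mul_ne_zero (pow_ne_zero _ (hc0 i)) ((map_ne_zero _).2 hθ0)
  have hcK : ∀ i, c i ^ p ∈ IntermediateField.adjoin K (Set.range s) := by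
    intro i
    have : c i ^ p = (algebraMap K Ω (L i) + s i) / algebraMap K Ω (2 * θ) := by
      rw [← hc i, eq_div_iff ((map_ne_zero _).2 (mul_ne_zero h2 hθ0)), map_mul, map_ofNat]; ring
    rw [this]
    exact div_mem (add_mem (IntermediateField.algebraMap_mem _ _) (hsm i))
      (IntermediateField.algebraMap_mem _ _)
  have hcΩ : LinearIndependent (IntermediateField.adjoin K (Set.range s))
      (fun n : ι → Fin p => ∏ i, c i ^ (n i : ℕ)) := by
    apply aux_linInd p hp.pos (algebraMap K (IntermediateField.adjoin K (Set.range s)) θ)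
    · exact hθ.map_of_injective (algebraMap K _).injective
    · intro n
      exact Finset.prod_ne_zero_iff.2 fun i _ => pow_ne_zero _ (hc0 i)
    · intro n
      have : (∏ i, c i ^ (n i : ℕ)) ^ p ∈ IntermediateField.adjoin K (Set.range s) := by
        rw [← Finset.prod_pow]
        refine prod_mem fun i _ => ?_
        rw [← pow_mul, mul_comm, pow_mul]
        exact pow_mem (hcK i) _
      exact ⟨⟨_, this⟩, rfl⟩
    · rintro m n hmn ⟨x, hx⟩
      obtain ⟨j, hj⟩ := Function.ne_iff.1 hmn
      refine aux_core p hp hodd h2 θ hθ L s hs hD hdick (fun i => c i ^ p * algebraMap K Ω θ) hc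
        (fun i => (m i : ℤ) - (n i : ℤ)) j ?_ (∏ i, (θ ^ ((m i : ℤ) - (n i : ℤ)))⁻¹) ?_
        (x : Ω) x.2 ?_
      · intro hdvd
        have hm := (m j).2
        have hn := (n j).2
        have := Int.eq_zero_of_abs_lt_dvd hdvd (by rw [abs_lt]; omega)
        apply hj
        ext
        omega
      · exact Finset.prod_ne_zero_iff.2 fun i _ => inv_ne_zero (zpow_ne_zero _ hθ0)
      · have hx' : (x : Ω) = (∏ i, c i ^ (m i : ℕ)) / ∏ i, c i ^ (n i : ℕ) := hx
        rw [hx', ← Finset.prod_div_distrib, ← Finset.prod_pow, map_prod, ← Finset.prod_mul_distrib]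
        refine Finset.prod_congr rfl fun i _ => ?_
        have hθ' : algebraMap K Ω θ ≠ 0 := (map_ne_zero _).2 hθ0
        have hz := zpow_ne_zero ((m i : ℤ) - (n i : ℤ)) hθ'
        rw [map_inv₀, map_zpow₀, mul_zpow, mul_comm (_ ^ _) (algebraMap K Ω θ ^ _),
          inv_mul_cancel_left₀ hz, ← zpow_natCast (c i) (m i : ℕ), ← zpow_natCast (c i) (n i : ℕ),
          ← zpow_sub₀ (hc0 i), ← zpow_natCast, ← zpow_natCast, ← zpow_mul, ← zpow_mul, mul_comm]
  have := linearIndependent_smul hb hcΩ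
  convert this using 1
  ext x
  rw [← hb' x.1]
  rfl

theorem aux_div {Ω : Type*} [Field Ω] {t : Ω} (h2 : (2 : Ω) ≠ 0) (ht : t ≠ 0) (x : Ω) :
    2 * (x / (2 * t) * t) = x := by
  field_simp

theorem aux_inj {A K Q Ω κ : Type*} [CommRing A] [Field K] [Algebra A K] [CommRing Q] [Algebra A Q]
    [Field Ω] [Algebra K Ω] [Fintype κ] (hinj : Function.Injective (algebraMap A K))
    (ψ : Q →+* Ω) (hψ : ∀ a, ψ (algebraMap A Q a) = algebraMap K Ω (algebraMap A K a))
    (b : κ → Q) (hb : Submodule.span A (Set.range b) = ⊤) (b' : κ → Ω)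
    (hLI : LinearIndependent K b') (hbb : ∀ x, ψ (b x) = b' x) : Function.Injective ψ := by
  rw [injective_iff_map_eq_zero]
  intro q hq
  have hqs : q ∈ Submodule.span A (Set.range b) := by rw [hb]; trivial
  obtain ⟨a, ha⟩ := (Submodule.mem_span_range_iff_exists_fun A).1 hqs
  have h0 : ∀ x, algebraMap A K (a x) = 0 := by
    apply Fintype.linearIndependent_iff.1 hLI
    rw [← hq, ← ha, map_sum]
    refine Finset.sum_congr rfl fun x _ => ?_
    rw [Algebra.smul_def, Algebra.smul_def, map_mul, hψ, hbb]
  rw [← ha]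
  refine Finset.sum_eq_zero fun x _ => ?_
  have : a x = 0 := hinj (by rw [h0, map_zero])
  rw [this, zero_smul]

theorem ideal_isPrime
    (p : ℕ) (hp : p.Prime) (hodd : Odd p)
    (F : Type*) [Field F] (hchar : ¬ (ringChar F ∣ 2 * p))
    (θ : F) (hθ : IsPrimitiveRoot θ p) :
    (Ideal.span {f : MvPolynomial (Fin 2 ⊕ Fin p) F |
      ∃ i : Fin p,
        f = (X (Sum.inr i) ^ p * C θ) ^ 2 -
            (C (θ ^ ((i : ℕ) + 1)) * X (Sum.inl 0) +
              C (θ⁻¹ ^ ((i : ℕ) + 1)) * X (Sum.inl 1)) *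
              (X (Sum.inr i) ^ p * C θ) + 1}).IsPrime := by
  have h2p : ((2 * p : ℕ) : F) ≠ 0 := fun h => hchar ((ringChar.spec F _).1 h)
  rw [Nat.cast_mul, Nat.cast_ofNat] at h2p
  have h2 : (2 : F) ≠ 0 := left_ne_zero_of_mul h2p
  have hpF : (p : F) ≠ 0 := right_ne_zero_of_mul h2p
  have hθ0 : θ ≠ 0 := hθ.ne_zero hp.ne_zero
  let α : Fin p → F := fun i => θ ^ ((i : ℕ) + 1)
  let β : Fin p → F := fun i => θ⁻¹ ^ ((i : ℕ) + 1)
  have hα : ∀ i, α i ≠ 0 := fun i => pow_ne_zero _ hθ0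
  have hαβ : ∀ i, α i * β i = 1 := by
    intro i
    simp only [α, β]
    rw [← mul_pow, mul_inv_cancel₀ hθ0, one_pow]
  have hne : ∀ i j, i ≠ j → α i * β j - α j * β i ≠ 0 := by
    intro i j hij h
    have h1 : α i ^ 2 = α j ^ 2 := by
      linear_combination (α i * α j) * h + α j ^ 2 * hαβ i - α i ^ 2 * hαβ j
    have hco : Nat.Coprime 2 p := (Nat.coprime_two_left).2 hodd
    have hθ2 := hθ.pow_of_coprime 2 hco
    simp only [α] at h1
    have h1' : (θ ^ 2) ^ (i : ℕ) * θ ^ 2 = (θ ^ 2) ^ (j : ℕ) * θ ^ 2 := by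
      linear_combination h1
    have h3 := mul_right_cancel₀ (pow_ne_zero 2 hθ0) h1'
    exact hij (Fin.ext (hθ2.pow_inj i.2 j.2 h3))
  let A := MvPolynomial (Fin 2) F
  let K := FractionRing A
  let Ω := SeparableClosure K
  have hinj : Function.Injective (algebraMap A K) := IsFractionRing.injective A K
  have hcinj : Function.Injective ((algebraMap A K).comp (C : F →+* A)) :=
    hinj.comp (C_injective _ _)
  have h2K : (2 : K) ≠ 0 := by
    intro h
    apply h2
    apply hcinj
    rw [map_ofNat, map_zero, h]
  have h2Ω : (2 : Ω) ≠ 0 := by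
    have := (map_ne_zero (algebraMap K Ω)).2 h2K
    rwa [map_ofNat] at this
  have hpΩ : (p : Ω) ≠ 0 := by
    intro h
    apply hpF
    apply hcinj
    apply (algebraMap K Ω).injective
    rw [map_natCast, map_natCast, map_zero, map_zero, h]
  have : NeZero ((2 : ℕ) : Ω) := ⟨by simpa using h2Ω⟩
  have : NeZero (p : Ω) := ⟨hpΩ⟩
  let θK : K := algebraMap A K (C θ)
  have hθK : IsPrimitiveRoot θK p := hθ.map_of_injective hcinj
  have hθK0 : algebraMap K Ω θK ≠ 0 := (map_ne_zero _).2 (hθK.ne_zero hp.ne_zero)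
  let L : Fin p → A := fun i => auxL (α i) (β i)
  choose s hs using fun i =>
    IsSepClosed.exists_pow_nat_eq (algebraMap K Ω (algebraMap A K (L i) ^ 2 - 4)) 2
  choose c hc' using fun i => IsSepClosed.exists_pow_nat_eq
    ((algebraMap K Ω (algebraMap A K (L i)) + s i) / (2 * algebraMap K Ω θK)) p
  have hc : ∀ i, 2 * (c i ^ p * algebraMap K Ω θK) =
      algebraMap K Ω (algebraMap A K (L i)) + s i := by
    intro i
    rw [hc']
    exact aux_div h2Ω hθK0 _
  have hquad : ∀ i, (c i ^ p * algebraMap K Ω θK) ^ 2 -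
      algebraMap K Ω (algebraMap A K (L i)) * (c i ^ p * algebraMap K Ω θK) + 1 = 0 := by
    intro i
    have h1 := hs i
    rw [map_sub, map_pow, map_ofNat] at h1
    have h4 : s i = 2 * (c i ^ p * algebraMap K Ω θK) -
      algebraMap K Ω (algebraMap A K (L i)) := by linear_combination -hc i
    rw [h4] at h1
    have h44 : (4 : Ω) ≠ 0 := by
      have : (4 : Ω) = 2 * 2 := by norm_num
      rw [this]; exact mul_ne_zero h2Ω h2Ω
    apply mul_left_cancel₀ h44
    linear_combination h1
  have hc0 : ∀ i, c i ≠ 0 := by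
    intro i h
    have := hquad i
    rw [h, zero_pow hp.ne_zero] at this
    simp at this
  have hLI := aux_linInd_main (ι := Fin p) p hp hodd h2K θK hθK (fun i => algebraMap A K (L i))
    s hs (by
      rintro D hD ⟨k, hk⟩
      apply aux_nsq h2 α β hα hne D hD k
      apply (algebraMap K Ω).injective
      rw [map_pow, hk, map_prod, map_prod, ← Finset.prod_pow]
      refine Finset.prod_congr rfl fun i _ => ?_
      rw [hs, map_sub (algebraMap (MvPolynomial (Fin 2) F) _), map_pow (algebraMap (MvPolynomial (Fin 2) F) _), map_ofNat (algebraMap (MvPolynomial (Fin 2) F) _)])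
    (fun j t => aux_dick_ne (α j) (β j) (hα j) p hp.two_le t) c hc hc0
  set I := (Ideal.span {f : MvPolynomial (Fin 2 ⊕ Fin p) F |
      ∃ i : Fin p,
        f = (X (Sum.inr i) ^ p * C θ) ^ 2 -
            (C (θ ^ ((i : ℕ) + 1)) * X (Sum.inl 0) +
              C (θ⁻¹ ^ ((i : ℕ) + 1)) * X (Sum.inl 1)) *
              (X (Sum.inr i) ^ p * C θ) + 1}) with hI
  let Q := MvPolynomial (Fin 2 ⊕ Fin p) F ⧸ I
  let g : A →+* Q := (Ideal.Quotient.mk I).comp (rename (R := F) Sum.inl : _ →ₐ[F] _).toRingHom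
  let _ : Algebra A Q := g.toAlgebra
  let ρ : A →+* Ω := (algebraMap K Ω).comp (algebraMap A K)
  let φ : MvPolynomial (Fin 2 ⊕ Fin p) F →+* Ω :=
    eval₂Hom (ρ.comp C) (Sum.elim (fun i => ρ (X i)) c)
  have hφC : ∀ x, φ (C x) = ρ (C x) := fun x => by simp [φ]
  have hφl : ∀ i, φ (X (Sum.inl i)) = ρ (X i) := fun i => by simp [φ]
  have hφr : ∀ i, φ (X (Sum.inr i)) = c i := fun i => by simp [φ]
  have hφI : ∀ a ∈ I, φ a = 0 := by
    have : I ≤ RingHom.ker φ := by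
      rw [hI, Ideal.span_le]
      rintro f ⟨i, rfl⟩
      rw [SetLike.mem_coe, RingHom.mem_ker]
      simp only [map_add, map_sub, map_mul, map_pow, map_one, hφl, hφr]
      have := hquad i
      simp only [L, auxL, α, β, θK, map_add, map_mul, map_pow] at this
      have hφC' : ∀ x, φ (C x) = algebraMap K Ω (algebraMap A K (C x)) := hφC
      simp only [hφC']
      exact this
    exact fun a ha => this ha
  let ψ : Q →+* Ω := Ideal.Quotient.lift I φ hφI
  have hψA : ∀ a : A, ψ (algebraMap A Q a) = ρ a := by
    intro a
    have : (ψ.comp g) = ρ := by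
      apply MvPolynomial.ringHom_ext
      · intro x
        change φ (rename Sum.inl (C x)) = _
        rw [rename_C, hφC]
      · intro i
        change φ (rename Sum.inl (X i)) = _
        rw [rename_X, hφl]
    exact DFunLike.congr_fun this a
  let cQ : Fin p → Q := fun i => Ideal.Quotient.mk I (X (Sum.inr i))
  have hψc : ∀ i, ψ (cQ i) = c i := fun i => hφr i
  let sQ : Fin p → Q := fun i => 2 * (cQ i ^ p * algebraMap A Q (C θ)) - algebraMap A Q (L i)
  have hψs : ∀ i, ψ (sQ i) = s i := by
    intro i
    simp only [sQ]
    rw [map_sub, map_mul, map_mul, map_pow, hψA, hψA, hψc, map_ofNat]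
    have := hc i
    simp only [ρ, RingHom.comp_apply]
    linear_combination this
  have hquadQ : ∀ i, (cQ i ^ p * algebraMap A Q (C θ)) ^ 2 -
      algebraMap A Q (L i) * (cQ i ^ p * algebraMap A Q (C θ)) + 1 = 0 := by
    intro i
    have hmem : (X (Sum.inr i) ^ p * C θ) ^ 2 -
            (C (θ ^ ((i : ℕ) + 1)) * X (Sum.inl 0) +
              C (θ⁻¹ ^ ((i : ℕ) + 1)) * X (Sum.inl 1)) *
              (X (Sum.inr i) ^ p * C θ) + 1 ∈ I := Ideal.subset_span ⟨i, rfl⟩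
    have h1 := Ideal.Quotient.eq_zero_iff_mem.2 hmem
    have hC : ∀ x, algebraMap A Q (C x) = Ideal.Quotient.mk I (C x) := by
      intro x
      change Ideal.Quotient.mk I (rename Sum.inl (C x)) = _
      rw [rename_C]
    have hL : algebraMap A Q (L i) = Ideal.Quotient.mk I (C (θ ^ ((i : ℕ) + 1)) * X (Sum.inl 0) +
              C (θ⁻¹ ^ ((i : ℕ) + 1)) * X (Sum.inl 1)) := by
      change Ideal.Quotient.mk I (rename Sum.inl (L i)) = _
      simp only [L, auxL, α, β]
      rw [map_add (rename _), map_mul (rename _), map_mul (rename _), rename_C, rename_C, rename_X,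
        rename_X]
    rw [hL, hC]
    rw [map_add, map_sub, map_mul, map_pow, map_mul, map_pow, map_one] at h1
    exact h1
  have hspan := aux_span (A := A) (Q := Q) p hp.pos sQ cQ (fun i => L i ^ 2 - 4)
    (fun i => C (2 * θ)⁻¹ * L i) (fun i => C (2 * θ)⁻¹) (by
      intro i
      simp only [sQ]
      rw [map_sub, map_pow, map_ofNat]
      linear_combination 4 * hquadQ i) (by
      intro i
      simp only [sQ]
      have h1 : algebraMap A Q (C (2 * θ)⁻¹) * (2 * algebraMap A Q (C θ)) = 1 := by
        rw [← map_ofNat (algebraMap A Q) 2, ← map_mul, ← map_mul,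
          ← map_ofNat (C : F →+* MvPolynomial (Fin 2) F) 2, ← map_mul, ← map_mul,
          inv_mul_cancel₀ (mul_ne_zero h2 hθ0), map_one, map_one]
      rw [map_mul]
      linear_combination -(cQ i ^ p) * h1) (by
      rw [eq_top_iff]
      rintro q -
      obtain ⟨f, rfl⟩ := Ideal.Quotient.mk_surjective q
      induction f using MvPolynomial.induction_on with
      | C a =>
        have : Ideal.Quotient.mk I (C a) = algebraMap A Q (C a) := by
          change _ = Ideal.Quotient.mk I (rename Sum.inl (C a))
          rw [rename_C]
        rw [this]
        exact Subalgebra.algebraMap_mem _ _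
      | add x y hx hy => rw [map_add]; exact add_mem hx hy
      | mul_X f i hf =>
        rw [map_mul]
        refine mul_mem hf ?_
        rcases i with i | i
        · have : Ideal.Quotient.mk I (X (Sum.inl i)) = algebraMap A Q (X i) := by
            change _ = Ideal.Quotient.mk I (rename Sum.inl (X i))
            rw [rename_X]
          rw [this]
          exact Subalgebra.algebraMap_mem _ _
        · exact Algebra.subset_adjoin ⟨i, rfl⟩)
  have hψinj : Function.Injective ψ := by
    refine aux_inj (A := A) (K := K) hinj ψ hψA _ hspan _ hLI ?_
    intro x
    rw [map_mul, map_prod, map_prod]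
    simp only [map_pow, hψs, hψc]
  rw [← Ideal.Quotient.isDomain_iff_prime]
  exact hψinj.isDomain ψ
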